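/- Let M be an abelian group with a filtration coming from a spectral sequence, and suppose π_2 fits in an exact sequence with an extension 0 → F_4[[u_1]] → π_2 → F_4[[u_1]] → 0 of F_4[[u_1]]-modules in which the extension is determined by: the class u^{-1} generating the quotient satisfies 2·u^{-1} = α²u_1 where α²u_1 generates u_1-multiples in the submodule. Then π_2 ≅ α² F_4 ⊕ u^{-1} W(F_4)/4 [[u_1]] as abelian groups; in particular the 2-torsion of π_2 that is not divisible by 2 is exactly α²F_4 ⊕ 2u^{-1}u_1-free part structure, and π_2 contains elements of order 4. -/

import Mathlib

/- STATEMENT 14: Suppose π₂ sits in an extension 0 → F₄[[u₁]] → π₂ → F₄[[u₁]] → 0 in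
which a lift x of any quotient element f satisfies 2x = i(u₁f) (the extension determined
by 2·u⁻¹ = α²u₁).  Then π₂ ≅ F₄ ⊕ W(F₄)/4[[u₁]] as abelian groups, and π₂ contains
elements of order 4. -/

noncomputable section

abbrev F4 := GaloisField 2 2
abbrev Wd := WittVector 2 F4
abbrev P14 := PowerSeries F4
-- W(F₄)/4
abbrev W4 := Wd ⧸ (Ideal.span {(4 : Wd)})

/-- An abelian group `A` of exponent `4`, generated modulo its doubles by lifts of a basis of an
`𝔽₂`-vector space `V` and by a `2`-torsion group `U`, with no further relations, is isomorphic to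
the direct sum of `U` and a free `ℤ/4`-module on that basis. -/
theorem nonempty_addEquiv_prod_finsupp_zmod_four {U V A ι : Type*} [AddCommGroup U]
    [AddCommGroup V] [Module (ZMod 2) V] [AddCommGroup A] (b : Module.Basis ι (ZMod 2) V)
    (j : U →+ A) (p : A →+ V) (hp : Function.Surjective p)
    (hA : ∀ a : A, 4 • a = 0) (hU : ∀ u : U, 2 • u = 0)
    (hpj : ∀ u, p (j u) = 0)
    (hker : ∀ a, p a = 0 → ∃ u c, a = j u + 2 • c)
    (hinj : ∀ u a, j u + 2 • a = 0 → u = 0 ∧ p a = 0) :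
    Nonempty (A ≃+ U × (ι →₀ ZMod 4)) := by
  let _ : Module (ZMod 4) A := AddCommGroup.zmodModule hA
  choose x hx using fun k => hp (b k)
  let L := Finsupp.linearCombination (ZMod 4) x
  let red : (ι →₀ ZMod 4) →+ (ι →₀ ZMod 2) :=
    Finsupp.mapRange.addMonoidHom (ZMod.castHom (by norm_num : 2 ∣ 4) (ZMod 2)).toAddMonoidHom
  have hpL : ∀ c, p (L c) = Finsupp.linearCombination (ZMod 2) b (red c) := by
    intro c
    induction c using Finsupp.induction_linear with
    | zero => simp
    | add f g hf hg => simp only [map_add, hf, hg]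
    | single k a =>
      obtain ⟨n, rfl⟩ := ZMod.natCast_zmod_surjective a
      simp [L, red, Nat.cast_smul_eq_nsmul, hx]
  have hred : ∀ c, p (L c) = 0 → ∃ d, c = 2 • d := by
    intro c hc
    rw [hpL] at hc
    have h0 : red c = 0 := by
      have h := (Finsupp.linearCombination (ZMod 2) b).map_zero
      exact b.linearIndependent (hc.trans h.symm)
    have key : ∀ z : ZMod 4, (ZMod.castHom (by norm_num : 2 ∣ 4) (ZMod 2)) z = 0 →
        2 • (if z = 2 then (1 : ZMod 4) else 0) = z := by decide
    refine ⟨c.mapRange (fun z => if z = 2 then (1 : ZMod 4) else 0) (by decide), ?_⟩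
    ext k
    have hk := DFunLike.congr_fun h0 k
    simp only [Finsupp.smul_apply, Finsupp.mapRange_apply]
    exact (key _ (by simpa [red] using hk)).symm
  have hlift : ∀ a, ∃ c, p (L c) = p a := by
    intro a
    refine ⟨(b.repr (p a)).mapRange (fun z : ZMod 2 => (z.val : ZMod 4)) (by decide), ?_⟩
    rw [hpL]
    conv_rhs => rw [← b.linearCombination_repr (p a)]
    congr 1
    ext k
    simp [red]
  have hdecomp : ∀ a, ∃ c u d, a = L c + j u + 2 • d := by
    intro a
    obtain ⟨c, hc⟩ := hlift a
    obtain ⟨u, d, h⟩ := hker (a - L c) (by rw [map_sub, hc, sub_self])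
    exact ⟨c, u, d, by rw [add_assoc, ← h]; abel⟩
  refine ⟨(AddEquiv.ofBijective (j.coprod L.toAddMonoidHom) ⟨?_, ?_⟩).symm⟩
  · rw [injective_iff_map_eq_zero]
    rintro ⟨u, c⟩ h
    replace h : j u + L c = 0 := h
    obtain ⟨d, rfl⟩ := hred c (by simpa [hpj] using congrArg p h)
    rw [map_nsmul] at h
    obtain ⟨rfl, hd⟩ := hinj _ _ h
    obtain ⟨e, rfl⟩ := hred d hd
    have he : 2 • 2 • e = 0 := by
      ext k
      simp only [Finsupp.smul_apply, Finsupp.zero_apply]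
      generalize e k = z
      revert z
      decide
    rw [he]
    rfl
  · intro a
    obtain ⟨c, u, d, rfl⟩ := hdecomp a
    obtain ⟨c', u', d', rfl⟩ := hdecomp d
    refine ⟨(u, c + 2 • c'), ?_⟩
    change j u + L (c + 2 • c') = _
    have h1 : 2 • j u' = 0 := by rw [← map_nsmul, hU, map_zero]
    have h2 : 2 • 2 • d' = 0 := by rw [← mul_nsmul]; exact hA d'
    rw [map_add, map_nsmul, nsmul_add, nsmul_add, h1, h2]
    abel

/-- The reduction `W(𝔽₄)/4 → 𝔽₄`. -/
def W4.residue : W4 →+* F4 :=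
  Ideal.Quotient.lift _ WittVector.constantCoeff fun a ha => by
    obtain ⟨c, rfl⟩ := Ideal.mem_span_singleton.mp ha
    have h2 : (2 : F4) = 0 := CharTwo.two_eq_zero
    have h4 : (4 : F4) = 0 := by linear_combination 2 * h2
    rw [map_mul, map_ofNat, h4, zero_mul]

theorem W4.residue_mk (w : Wd) :
    W4.residue (Ideal.Quotient.mk _ w) = WittVector.constantCoeff w := rfl

theorem W4.residue_surjective : Function.Surjective W4.residue := fun a =>
  ⟨Ideal.Quotient.mk _ (WittVector.teichmuller 2 a), WittVector.teichmuller_coeff_zero 2 a⟩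

theorem W4.exists_eq_two_mul_of_residue_eq_zero (w : W4) (h : W4.residue w = 0) :
    ∃ v, w = 2 * v := by
  obtain ⟨w, rfl⟩ := Ideal.Quotient.mk_surjective w
  have h0 : w.coeff 0 = 0 := h
  have hV : w = WittVector.verschiebung (w.shift 1) := by
    simpa using WittVector.eq_iterate_verschiebung (n := 1) (x := w)
      (by intro k hk; obtain rfl : k = 0 := by lia
          exact h0)
  obtain ⟨z, hz⟩ := (WittVector.frobenius_bijective (p := 2) F4).surjective (w.shift 1)
  refine ⟨Ideal.Quotient.mk _ z, ?_⟩
  rw [hV, ← hz, WittVector.verschiebung_frobenius, map_mul, mul_comm, Nat.cast_ofNat,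
    map_ofNat]

theorem W4.residue_eq_zero_of_two_mul_eq_zero (w : W4) (h : 2 * w = 0) :
    W4.residue w = 0 := by
  obtain ⟨w, rfl⟩ := Ideal.Quotient.mk_surjective w
  have hw : (2 * w : Wd) ∈ Ideal.span {(4 : Wd)} := by
    rw [← Ideal.Quotient.eq_zero_iff_mem, map_mul, map_ofNat]
    exact h
  obtain ⟨v, hv⟩ := Ideal.mem_span_singleton.mp hw
  have h2 : (2 : Wd) ≠ 0 := by exact_mod_cast WittVector.p_nonzero 2 F4
  have hwv : w = 2 * v := mul_left_cancel₀ h2 (by rw [hv]; ring)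
  have h0 : (2 : F4) = 0 := CharTwo.two_eq_zero
  rw [W4.residue_mk, hwv, map_mul, map_ofNat, h0, zero_mul]

theorem W4.four_eq_zero : (4 : W4) = 0 := by
  have h := Ideal.Quotient.eq_zero_iff_mem.mpr (Ideal.mem_span_singleton_self (4 : Wd))
  rwa [map_ofNat] at h

theorem F4.two_nsmul_eq_zero (a : F4) : 2 • a = 0 := by
  rw [two_nsmul, CharTwo.add_self_eq_zero]

theorem P14.two_nsmul_eq_zero (f : P14) : 2 • f = 0 := by
  ext n
  rw [map_nsmul, F4.two_nsmul_eq_zero, map_zero]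

/-- `𝔽₄ ⊕ W(𝔽₄)/4[[u₁]]` is `𝔽₄` plus a free `ℤ/4`-module on a basis of `𝔽₄[[u₁]]`. -/
theorem nonempty_prod_powerSeries_W4_addEquiv {ι : Type*} [Module (ZMod 2) P14]
    (b : Module.Basis ι (ZMod 2) P14) :
    Nonempty (F4 × PowerSeries W4 ≃+ F4 × (ι →₀ ZMod 4)) := by
  refine nonempty_addEquiv_prod_finsupp_zmod_four b (AddMonoidHom.inl F4 (PowerSeries W4))
    ((PowerSeries.map W4.residue).toAddMonoidHom.comp (AddMonoidHom.snd F4 (PowerSeries W4)))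
    ?_ ?_ F4.two_nsmul_eq_zero ?_ ?_ ?_
  · intro f
    obtain ⟨g, hg⟩ := PowerSeries.map_surjective _ W4.residue_surjective f
    exact ⟨(0, g), hg⟩
  · rintro ⟨a, f⟩
    refine Prod.ext ?_ ?_
    · change (2 * 2) • a = 0
      rw [mul_nsmul, F4.two_nsmul_eq_zero]
    · change 4 • f = 0
      ext n
      rw [map_nsmul, nsmul_eq_mul, Nat.cast_ofNat, W4.four_eq_zero, zero_mul, map_zero]
  · intro u
    simp
  · rintro ⟨a, f⟩ h
    replace h : PowerSeries.map W4.residue f = 0 := h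
    choose g hg using fun n => W4.exists_eq_two_mul_of_residue_eq_zero (PowerSeries.coeff n f)
      (by rw [← PowerSeries.coeff_map, h, map_zero])
    refine ⟨a, (0, PowerSeries.mk g), Prod.ext (by simp) ?_⟩
    change f = 0 + 2 • PowerSeries.mk g
    ext n
    rw [zero_add, map_nsmul, PowerSeries.coeff_mk, hg, nsmul_eq_mul, Nat.cast_ofNat]
  · rintro u ⟨a, f⟩ h
    have h1 : u + 2 • a = 0 := congrArg Prod.fst h
    have h2 : 0 + 2 • f = 0 := congrArg Prod.snd h
    refine ⟨by rwa [F4.two_nsmul_eq_zero, add_zero] at h1, ?_⟩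
    change PowerSeries.map W4.residue f = 0
    ext n
    rw [PowerSeries.coeff_map, map_zero]
    apply W4.residue_eq_zero_of_two_mul_eq_zero
    have hn := congrArg (PowerSeries.coeff n) h2
    rwa [zero_add, map_nsmul, map_zero, nsmul_eq_mul, Nat.cast_ofNat] at hn

theorem statement14
    (π2 : Type) [AddCommGroup π2]
    (i : P14 →+ π2) (p : π2 →+ P14)
    (hi : Function.Injective i) (hp : Function.Surjective p)
    (hexact : Function.Exact i p)
    -- the extension is determined by 2·(lift of f) = i(u₁·f)
    (hext : ∀ f : P14, ∃ x : π2, p x = f ∧ (2 : ℤ) • x = i (PowerSeries.X * f)) :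
    Nonempty (π2 ≃+ F4 × PowerSeries W4) ∧
    ∃ x : π2, addOrderOf x = 4 := by
  have hpi : ∀ f, p (i f) = 0 := fun f => (hexact _).mpr ⟨f, rfl⟩
  have htwo_i : ∀ f, 2 • i f = 0 := fun f => by rw [← map_nsmul, P14.two_nsmul_eq_zero, map_zero]
  have htwo : ∀ a, 2 • a = i (PowerSeries.X * p a) := by
    intro a
    obtain ⟨x, hx, hx2⟩ := hext (p a)
    obtain ⟨g, hg⟩ := (hexact (a - x)).mp (by rw [map_sub, hx, sub_self])
    have h := htwo_i g
    rw [hg, nsmul_sub, sub_eq_zero] at h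
    rw [h, ← hx2]
    exact (natCast_zsmul x 2).symm
  have hfour : ∀ a : π2, 4 • a = 0 := fun a => by
    rw [show 4 = 2 * 2 from rfl, mul_nsmul, htwo a, htwo_i]
  constructor
  · let _ : Module (ZMod 2) P14 := AddCommGroup.zmodModule P14.two_nsmul_eq_zero
    let b := Module.Basis.ofVectorSpace (ZMod 2) P14
    obtain ⟨e⟩ := nonempty_prod_powerSeries_W4_addEquiv b
    have hπ : Nonempty (π2 ≃+ F4 × (_ →₀ ZMod 4)) :=
      nonempty_addEquiv_prod_finsupp_zmod_four b
        (i.comp (PowerSeries.C (R := F4)).toAddMonoidHom) p hp hfour F4.two_nsmul_eq_zero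
        (fun u => hpi _) ?_ ?_
    · exact hπ.map fun e' => e'.trans e.symm
    · intro a ha
      obtain ⟨f, rfl⟩ := (hexact a).mp ha
      obtain ⟨c, hc⟩ := hp (PowerSeries.mk fun n => PowerSeries.coeff (n + 1) f)
      refine ⟨PowerSeries.constantCoeff f, c, ?_⟩
      rw [htwo, hc]
      change _ = i (PowerSeries.C (PowerSeries.constantCoeff f)) + _
      rw [← map_add, add_comm, ← PowerSeries.eq_X_mul_shift_add_const]
    · intro u a h
      rw [htwo] at h
      change i (PowerSeries.C u) + _ = 0 at h
      rw [← map_add] at h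
      have h0 := (injective_iff_map_eq_zero i).mp hi _ h
      have hu : u = 0 := by simpa using congrArg PowerSeries.constantCoeff h0
      subst hu
      exact ⟨rfl, by simpa [PowerSeries.X_ne_zero] using h0⟩
  · obtain ⟨x, hx⟩ := hp 1
    refine ⟨x, addOrderOf_eq_prime_pow (p := 2) (n := 1) ?_ (hfour x)⟩
    rw [pow_one, htwo, hx, mul_one]
    exact fun h => PowerSeries.X_ne_zero ((injective_iff_map_eq_zero i).mp hi _ h)
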